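/- Let Γ be a finite tree (a connected acyclic simple graph) with more than two vertices, let Γ⁰ be an orientation of Γ in which every vertex is a source or a sink, and let Γ¹ be the opposite orientation. Then there is a bijection between the set of isomorphism classes of indecomposable finite-dimensional left A(Γ)-modules and the disjoint union of the set of isomorphism classes of indecomposable finite-dimensional left B(Γ⁰)-modules and the set of isomorphism classes of indecomposable finite-dimensional left B(Γ¹)-modules. (Equivalently, there is a natural two-to-one correspondence between isomorphism classes of indecomposable A(Γ)-modules and isomorphism classes of indecomposable B(Γ⁰)-modules.) -/

import Mathlib

/-!
The zigzag algebra `A(Γ)` of a finite simple graph `Γ`, presented as a quotient of the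
free algebra on generators `{e_a : a ∈ V} ∪ {x_{ab} : a,b adjacent}`.
-/

noncomputable section

/-- Generators of the zigzag algebra: one idempotent `e_a` per vertex `a`, and one
generator `x_{ab}` (the arrow `a → b` in the double quiver) per ordered adjacent pair. -/
def ZigzagGen {V : Type} (G : SimpleGraph V) : Type :=
  V ⊕ {p : V × V // G.Adj p.1 p.2}

/-- The idempotent generator `e_a` inside the free algebra. -/
def zge (k : Type) [CommRing k] {V : Type} (G : SimpleGraph V) (a : V) :
    FreeAlgebra k (ZigzagGen G) :=
  FreeAlgebra.ι k (Sum.inl a)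

/-- The arrow generator `x_{ab}` inside the free algebra. -/
def zgx (k : Type) [CommRing k] {V : Type} (G : SimpleGraph V) {a b : V} (h : G.Adj a b) :
    FreeAlgebra k (ZigzagGen G) :=
  FreeAlgebra.ι k (Sum.inr ⟨(a, b), h⟩)

/-- The defining relations of the zigzag algebra `A(Γ)`:
`e_a e_b = δ_{ab} e_a`, `Σ_a e_a = 1`, `e_b x_{ab} = x_{ab} = x_{ab} e_a`,
`x_{bc} x_{ab} = 0` for `c ≠ a`, and `x_{ba} x_{ab} = x_{ca} x_{ac}`. -/
inductive ZigzagRel (k : Type) [CommRing k] {V : Type} [Fintype V] (G : SimpleGraph V) :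
    FreeAlgebra k (ZigzagGen G) → FreeAlgebra k (ZigzagGen G) → Prop
  | idem (a : V) : ZigzagRel k G (zge k G a * zge k G a) (zge k G a)
  | orth (a b : V) (h : a ≠ b) : ZigzagRel k G (zge k G a * zge k G b) 0
  | sum_one : ZigzagRel k G (∑ a : V, zge k G a) 1
  | target_id {a b : V} (h : G.Adj a b) :
      ZigzagRel k G (zge k G b * zgx k G h) (zgx k G h)
  | source_id {a b : V} (h : G.Adj a b) :
      ZigzagRel k G (zgx k G h * zge k G a) (zgx k G h)
  | comp_zero {a b c : V} (h₁ : G.Adj a b) (h₂ : G.Adj b c) (hca : c ≠ a) :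
      ZigzagRel k G (zgx k G h₂ * zgx k G h₁) 0
  | zigzag {a b c : V} (hab : G.Adj a b) (hac : G.Adj a c) :
      ZigzagRel k G (zgx k G hab.symm * zgx k G hab) (zgx k G hac.symm * zgx k G hac)

/-- The zigzag algebra `A(Γ)`. -/
abbrev ZigzagAlgebra (k : Type) [CommRing k] {V : Type} [Fintype V] (G : SimpleGraph V) : Type :=
  RingQuot (ZigzagRel k G)

/-- The idempotent `e_a` of the zigzag algebra. -/
def ZigzagAlgebra.e (k : Type) [CommRing k] {V : Type} [Fintype V] (G : SimpleGraph V)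
    (a : V) : ZigzagAlgebra k G :=
  RingQuot.mkAlgHom k (ZigzagRel k G) (zge k G a)

/-! ### The path algebra of a sink-source orientation -/

/-- Generators of the path algebra `B(Γ⁰)`: one idempotent per vertex and one generator
per arrow of the orientation `O`. -/
def OrGen {V : Type} (O : V → V → Prop) : Type :=
  V ⊕ {p : V × V // O p.1 p.2}

/-- The defining relations of the path algebra `B(Γ⁰)` of a sink-source orientation:
the `e_a` are orthogonal idempotents summing to `1`, an arrow `f : a → b` satisfies
`e_b f = f = f e_a`, and the product of any two arrows is zero. -/
inductive OrRel (k : Type) [CommRing k] {V : Type} [Fintype V] (O : V → V → Prop) :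
    FreeAlgebra k (OrGen O) → FreeAlgebra k (OrGen O) → Prop
  | idem (a : V) :
      OrRel k O (FreeAlgebra.ι k (Sum.inl a : OrGen O) * FreeAlgebra.ι k (Sum.inl a))
        (FreeAlgebra.ι k (Sum.inl a))
  | orth (a b : V) (h : a ≠ b) :
      OrRel k O (FreeAlgebra.ι k (Sum.inl a : OrGen O) * FreeAlgebra.ι k (Sum.inl b)) 0
  | sum_one : OrRel k O (∑ a : V, FreeAlgebra.ι k (Sum.inl a : OrGen O)) 1
  | target_id {a b : V} (h : O a b) :
      OrRel k O (FreeAlgebra.ι k (Sum.inl b : OrGen O) * FreeAlgebra.ι k (Sum.inr ⟨(a, b), h⟩))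
        (FreeAlgebra.ι k (Sum.inr ⟨(a, b), h⟩))
  | source_id {a b : V} (h : O a b) :
      OrRel k O (FreeAlgebra.ι k (Sum.inr ⟨(a, b), h⟩ : OrGen O) * FreeAlgebra.ι k (Sum.inl a))
        (FreeAlgebra.ι k (Sum.inr ⟨(a, b), h⟩))
  | arrows_zero (p q : {p : V × V // O p.1 p.2}) :
      OrRel k O (FreeAlgebra.ι k (Sum.inr p : OrGen O) * FreeAlgebra.ι k (Sum.inr q)) 0

/-- The path algebra `B(Γ⁰)` of a sink-source orientation `Γ⁰`. -/
abbrev PathAlgebra (k : Type) [CommRing k] {V : Type} [Fintype V]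
    (O : V → V → Prop) : Type :=
  RingQuot (OrRel k O)

/-! ### Isomorphism classes of finite-dimensional indecomposable modules -/

/-- A bundled left module over a ring `R`. -/
structure ModRep (R : Type) [Ring R] : Type 1 where
  /-- the underlying type -/
  carrier : Type
  [isAddCommGroup : AddCommGroup carrier]
  [isModule : Module R carrier]

attribute [instance] ModRep.isAddCommGroup ModRep.isModule

/-- A module is indecomposable if it is nonzero and admits no nontrivial direct sum
decomposition: whenever two submodules are complementary, one of them is everything. -/
def IsIndecomposableModule (R : Type) [Ring R] (M : Type) [AddCommGroup M]
    [Module R M] : Prop :=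
  Nontrivial M ∧ ∀ N₁ N₂ : Submodule R M, IsCompl N₁ N₂ → N₁ = ⊤ ∨ N₂ = ⊤

/-- Linear isomorphism, as an equivalence relation on bundled finite-dimensional
indecomposable modules. -/
def isoSetoid (R : Type) [Ring R] :
    Setoid {M : ModRep R // Module.Finite R M.carrier ∧ IsIndecomposableModule R M.carrier} where
  r M N := Nonempty (M.1.carrier ≃ₗ[R] N.1.carrier)
  iseqv :=
    ⟨fun _ => ⟨LinearEquiv.refl _ _⟩, fun ⟨e⟩ => ⟨e.symm⟩, fun ⟨e⟩ ⟨f⟩ => ⟨e.trans f⟩⟩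

/-- The set of isomorphism classes of finite-dimensional indecomposable left
`R`-modules. -/
def IndecClasses (R : Type) [Ring R] : Type 1 :=
  Quotient (isoSetoid R)

/-! ### Generators and relations in the zigzag algebra -/

open scoped Classical in
/-- The arrow `x_{ab}` of the zigzag algebra, extended by zero to non-adjacent pairs. -/
def ZigzagAlgebra.x (k : Type) [CommRing k] {V : Type} [Fintype V] (G : SimpleGraph V)
    (a b : V) : ZigzagAlgebra k G :=
  if h : G.Adj a b then RingQuot.mkAlgHom k (ZigzagRel k G) (zgx k G h) else 0

open scoped Classical in
/-- The loop `x_{ba} x_{ab}` at `a`, which does not depend on the neighbour `b` of `a`. -/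
def ZigzagAlgebra.loop (k : Type) [CommRing k] {V : Type} [Fintype V] (G : SimpleGraph V)
    (a : V) : ZigzagAlgebra k G :=
  if h : ∃ b, G.Adj a b then ZigzagAlgebra.x k G h.choose a * ZigzagAlgebra.x k G a h.choose
  else 0

namespace ZigzagAlgebra

variable {k : Type} [CommRing k] {V : Type} [Fintype V] {G : SimpleGraph V}

theorem x_of_adj {a b : V} (h : G.Adj a b) :
    x k G a b = RingQuot.mkAlgHom k (ZigzagRel k G) (zgx k G h) :=
  dif_pos h

theorem x_of_not_adj {a b : V} (h : ¬ G.Adj a b) : x k G a b = 0 :=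
  dif_neg h

theorem e_mul_self (a : V) : e k G a * e k G a = e k G a := by
  simpa [e] using RingQuot.mkAlgHom_rel k (ZigzagRel.idem (k := k) (G := G) a)

theorem e_mul_e_of_ne {a b : V} (h : a ≠ b) : e k G a * e k G b = 0 := by
  simpa [e] using RingQuot.mkAlgHom_rel k (ZigzagRel.orth (k := k) (G := G) a b h)

theorem sum_e : ∑ a, e k G a = 1 := by
  simpa [e] using RingQuot.mkAlgHom_rel k (ZigzagRel.sum_one (k := k) (G := G))

theorem e_mul_x (a b : V) : e k G b * x k G a b = x k G a b := by
  by_cases h : G.Adj a b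
  · simpa [e, x_of_adj h] using RingQuot.mkAlgHom_rel k (ZigzagRel.target_id (k := k) h)
  · simp [x_of_not_adj h]

theorem x_mul_e (a b : V) : x k G a b * e k G a = x k G a b := by
  by_cases h : G.Adj a b
  · simpa [e, x_of_adj h] using RingQuot.mkAlgHom_rel k (ZigzagRel.source_id (k := k) h)
  · simp [x_of_not_adj h]

theorem e_mul_x_of_ne {a b c : V} (h : c ≠ b) : e k G c * x k G a b = 0 := by
  rw [← e_mul_x, ← mul_assoc, e_mul_e_of_ne h, zero_mul]

theorem x_mul_e_of_ne {a b c : V} (h : a ≠ c) : x k G a b * e k G c = 0 := by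
  rw [← x_mul_e, mul_assoc, e_mul_e_of_ne h, mul_zero]

theorem x_mul_x_of_ne_mid {a b c d : V} (h : c ≠ b) : x k G c d * x k G a b = 0 := by
  rw [← e_mul_x a b, ← mul_assoc, x_mul_e_of_ne h, zero_mul]

theorem x_mul_x_of_ne {a b c : V} (h : c ≠ a) : x k G b c * x k G a b = 0 := by
  by_cases h₁ : G.Adj a b
  · by_cases h₂ : G.Adj b c
    · simpa [x_of_adj h₁, x_of_adj h₂] using
        RingQuot.mkAlgHom_rel k (ZigzagRel.comp_zero (k := k) h₁ h₂ h)
    · simp [x_of_not_adj h₂]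
  · simp [x_of_not_adj h₁]

theorem x_mul_x_eq_loop {a b : V} (h : G.Adj a b) : x k G b a * x k G a b = loop k G a := by
  have hex : ∃ b, G.Adj a b := ⟨b, h⟩
  have h' := hex.choose_spec
  rw [loop, dif_pos hex, x_of_adj h, x_of_adj h.symm, x_of_adj h', x_of_adj h'.symm]
  simpa using RingQuot.mkAlgHom_rel k (ZigzagRel.zigzag (k := k) h h')

theorem loop_of_forall_not_adj {a : V} (h : ∀ b, ¬ G.Adj a b) : loop k G a = 0 :=
  dif_neg (by simpa using h)

theorem e_mul_loop (a : V) : e k G a * loop k G a = loop k G a := by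
  by_cases h : ∃ b, G.Adj a b
  · obtain ⟨b, hb⟩ := h
    rw [← x_mul_x_eq_loop hb, ← mul_assoc, e_mul_x]
  · simp [loop_of_forall_not_adj (not_exists.1 h)]

theorem loop_mul_e (a : V) : loop k G a * e k G a = loop k G a := by
  by_cases h : ∃ b, G.Adj a b
  · obtain ⟨b, hb⟩ := h
    rw [← x_mul_x_eq_loop hb, mul_assoc, x_mul_e]
  · simp [loop_of_forall_not_adj (not_exists.1 h)]

theorem e_mul_loop_of_ne {a c : V} (h : c ≠ a) : e k G c * loop k G a = 0 := by
  rw [← e_mul_loop, ← mul_assoc, e_mul_e_of_ne h, zero_mul]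

theorem loop_mul_e_of_ne {a c : V} (h : a ≠ c) : loop k G a * e k G c = 0 := by
  rw [← loop_mul_e, mul_assoc, e_mul_e_of_ne h, mul_zero]

/-- In a connected graph with more than two vertices, every edge has a neighbouring edge. -/
theorem _root_.SimpleGraph.Connected.exists_adj_ne_of_two_lt_card (hG : G.Connected)
    (hcard : 2 < Fintype.card V) {a b : V} (hab : G.Adj a b) :
    ∃ c, (G.Adj a c ∧ c ≠ b) ∨ (G.Adj b c ∧ c ≠ a) := by
  classical
  by_contra! hc
  have key : ∀ u v (p : G.Walk u v), (u = a ∨ u = b) → (v = a ∨ v = b) := by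
    intro u v p
    induction p with
    | nil => exact id
    | cons h p ih =>
      rintro (rfl | rfl)
      · exact ih (.inr ((hc _).1 h))
      · exact ih (.inl ((hc _).2 h))
  have huniv : (Finset.univ : Finset V) ⊆ {a, b} := by
    intro v _
    obtain ⟨p⟩ := hG.preconnected a v
    simpa using key a v p (.inl rfl)
  have := Finset.card_le_card huniv
  have := Finset.card_le_two (a := a) (b := b)
  simp only [Finset.card_univ] at *
  omega

theorem x_mul_x_mul_x (hG : G.Connected) (hcard : 2 < Fintype.card V) (a b : V) :
    x k G a b * x k G b a * x k G a b = 0 := by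
  by_cases hab : G.Adj a b
  · obtain ⟨c, ⟨hac, hc⟩ | ⟨hbc, hc⟩⟩ := hG.exists_adj_ne_of_two_lt_card hcard hab
    · rw [mul_assoc, x_mul_x_eq_loop hab, ← x_mul_x_eq_loop hac, ← mul_assoc,
        x_mul_x_of_ne hc.symm, zero_mul]
    · rw [x_mul_x_eq_loop hab.symm, ← x_mul_x_eq_loop hbc, mul_assoc, x_mul_x_of_ne hc, mul_zero]
  · simp [x_of_not_adj hab]

theorem x_mul_loop (hG : G.Connected) (hcard : 2 < Fintype.card V) (a b c : V) :
    x k G c b * loop k G a = 0 := by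
  obtain rfl | hca := eq_or_ne c a
  · by_cases hab : G.Adj c b
    · rw [← x_mul_x_eq_loop hab, ← mul_assoc, x_mul_x_mul_x hG hcard]
    · rw [x_of_not_adj hab, zero_mul]
  · rw [← e_mul_loop, ← mul_assoc, x_mul_e_of_ne hca, zero_mul]

theorem loop_mul_x (hG : G.Connected) (hcard : 2 < Fintype.card V) (a b c : V) :
    loop k G a * x k G b c = 0 := by
  obtain rfl | hca := eq_or_ne a c
  · by_cases hab : G.Adj b a
    · rw [← x_mul_x_eq_loop hab.symm, x_mul_x_mul_x hG hcard]
    · rw [x_of_not_adj hab, mul_zero]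
  · rw [← loop_mul_e, mul_assoc, e_mul_x_of_ne hca, mul_zero]

theorem loop_mul_loop (hG : G.Connected) (hcard : 2 < Fintype.card V) (a b : V) :
    loop k G a * loop k G b = 0 := by
  by_cases h : ∃ c, G.Adj b c
  · obtain ⟨c, hc⟩ := h
    rw [← x_mul_x_eq_loop hc, ← mul_assoc, loop_mul_x hG hcard, zero_mul]
  · simp [loop_of_forall_not_adj (not_exists.1 h)]

/-- A property closed under ring operations holds everywhere once it holds on generators. -/
theorem induction {P : ZigzagAlgebra k G → Prop} (halg : ∀ c, P (algebraMap k _ c))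
    (he : ∀ a, P (e k G a)) (hx : ∀ a b, P (x k G a b))
    (hmul : ∀ y z, P y → P z → P (y * z)) (hadd : ∀ y z, P y → P z → P (y + z))
    (y : ZigzagAlgebra k G) : P y := by
  obtain ⟨z, rfl⟩ := RingQuot.mkAlgHom_surjective k _ y
  induction z using FreeAlgebra.induction with
  | grade0 r => simpa using halg r
  | grade1 g =>
    obtain a | ⟨⟨a, b⟩, h⟩ := g
    · exact he a
    · have := hx a b
      rwa [x_of_adj h] at this
  | mul y z hy hz => simpa using hmul _ _ hy hz
  | add y z hy hz => simpa using hadd _ _ hy hz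

/-- The universal property of the zigzag algebra. -/
theorem exists_algHom {C : Type} [Ring C] [Algebra k C] (E : V → C) (F : V → V → C)
    (idem : ∀ a, E a * E a = E a) (orth : ∀ a b, a ≠ b → E a * E b = 0)
    (sum_one : ∑ a, E a = 1) (target_id : ∀ a b, E b * F a b = F a b)
    (source_id : ∀ a b, F a b * E a = F a b)
    (comp_zero : ∀ a b c, c ≠ a → F b c * F a b = 0)
    (zigzag : ∀ a b c, F b a * F a b = F c a * F a c) :
    ∃ f : ZigzagAlgebra k G →ₐ[k] C,
      (∀ a, f (e k G a) = E a) ∧ ∀ a b, G.Adj a b → f (x k G a b) = F a b := by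
  let g : FreeAlgebra k (ZigzagGen G) →ₐ[k] C :=
    FreeAlgebra.lift k (Sum.elim E fun p => F p.1.1 p.1.2)
  have hge (a : V) : g (zge k G a) = E a := by
    simp only [g, zge]; exact FreeAlgebra.lift_ι_apply _ _
  have hgx {a b : V} (h : G.Adj a b) : g (zgx k G h) = F a b := by
    simp only [g, zgx]; exact FreeAlgebra.lift_ι_apply _ _
  have hg : ∀ ⦃y z⦄, ZigzagRel k G y z → g y = g z := by
    intro y z h
    induction h <;> simp only [map_mul, map_sum, map_one, map_zero, *]
    · exact orth _ _ ‹_›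
    · exact comp_zero _ _ _ ‹_›
    · exact zigzag _ _ _
  refine ⟨RingQuot.liftAlgHom k ⟨g, hg⟩, fun a => ?_, fun a b h => ?_⟩
  · rw [e, RingQuot.liftAlgHom_mkAlgHom_apply, hge]
  · rw [x_of_adj h, RingQuot.liftAlgHom_mkAlgHom_apply, hgx]

end ZigzagAlgebra

/-! ### Generators and relations in the path algebra -/

namespace PathAlgebra

variable {k : Type} [CommRing k] {V : Type} [Fintype V] {O : V → V → Prop}

variable (k O) in
/-- The idempotent `e_a` of the path algebra. -/
def e (a : V) : PathAlgebra k O :=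
  RingQuot.mkAlgHom k (OrRel k O) (FreeAlgebra.ι k (Sum.inl a : OrGen O))

variable (k O) in
open scoped Classical in
/-- The arrow `a → b` of the path algebra, extended by zero to the pairs without an arrow. -/
def x (a b : V) : PathAlgebra k O :=
  if h : O a b then
    RingQuot.mkAlgHom k (OrRel k O) (FreeAlgebra.ι k (Sum.inr ⟨(a, b), h⟩ : OrGen O))
  else 0

theorem x_of_arrow {a b : V} (h : O a b) : x k O a b =
    RingQuot.mkAlgHom k (OrRel k O) (FreeAlgebra.ι k (Sum.inr ⟨(a, b), h⟩ : OrGen O)) :=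
  dif_pos h

theorem x_of_not_arrow {a b : V} (h : ¬ O a b) : x k O a b = 0 :=
  dif_neg h

theorem e_mul_self (a : V) : e k O a * e k O a = e k O a := by
  exact (map_mul (RingQuot.mkAlgHom k (OrRel k O)) _ _).symm.trans
    (RingQuot.mkAlgHom_rel k (OrRel.idem (k := k) (O := O) a))

theorem e_mul_e_of_ne {a b : V} (h : a ≠ b) : e k O a * e k O b = 0 := by
  exact (map_mul (RingQuot.mkAlgHom k (OrRel k O)) _ _).symm.trans
    ((RingQuot.mkAlgHom_rel k (OrRel.orth (k := k) (O := O) a b h)).trans (map_zero _))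

theorem sum_e : ∑ a, e k O a = 1 := by
  simpa [e] using RingQuot.mkAlgHom_rel k (OrRel.sum_one (k := k) (O := O))

theorem e_mul_x (a b : V) : e k O b * x k O a b = x k O a b := by
  by_cases h : O a b
  · rw [x_of_arrow h]
    exact (map_mul (RingQuot.mkAlgHom k (OrRel k O)) _ _).symm.trans
      (RingQuot.mkAlgHom_rel k (OrRel.target_id (k := k) h))
  · simp [x_of_not_arrow h]

theorem x_mul_e (a b : V) : x k O a b * e k O a = x k O a b := by
  by_cases h : O a b
  · rw [x_of_arrow h]
    exact (map_mul (RingQuot.mkAlgHom k (OrRel k O)) _ _).symm.trans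
      (RingQuot.mkAlgHom_rel k (OrRel.source_id (k := k) h))
  · simp [x_of_not_arrow h]

theorem x_mul_x (a b c d : V) : x k O a b * x k O c d = 0 := by
  by_cases h₁ : O a b
  · by_cases h₂ : O c d
    · rw [x_of_arrow h₁, x_of_arrow h₂]
      exact (map_mul (RingQuot.mkAlgHom k (OrRel k O)) _ _).symm.trans
        ((RingQuot.mkAlgHom_rel k (OrRel.arrows_zero (k := k) ⟨(a, b), h₁⟩ ⟨(c, d), h₂⟩)).trans
          (map_zero _))
    · simp [x_of_not_arrow h₂]
  · simp [x_of_not_arrow h₁]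

/-- A property closed under ring operations holds everywhere once it holds on generators. -/
theorem induction {P : PathAlgebra k O → Prop} (halg : ∀ c, P (algebraMap k _ c))
    (he : ∀ a, P (e k O a)) (hx : ∀ a b, O a b → P (x k O a b))
    (hmul : ∀ y z, P y → P z → P (y * z)) (hadd : ∀ y z, P y → P z → P (y + z))
    (y : PathAlgebra k O) : P y := by
  obtain ⟨z, rfl⟩ := RingQuot.mkAlgHom_surjective k _ y
  induction z using FreeAlgebra.induction with
  | grade0 r => simpa using halg r
  | grade1 g =>
    obtain a | ⟨⟨a, b⟩, h⟩ := g
    · exact he a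
    · have := hx a b h
      rwa [x_of_arrow h] at this
  | mul y z hy hz => simpa using hmul _ _ hy hz
  | add y z hy hz => simpa using hadd _ _ hy hz

/-- The universal property of the path algebra. -/
theorem exists_algHom {C : Type} [Ring C] [Algebra k C] (E : V → C) (F : V → V → C)
    (idem : ∀ a, E a * E a = E a) (orth : ∀ a b, a ≠ b → E a * E b = 0)
    (sum_one : ∑ a, E a = 1) (target_id : ∀ a b, E b * F a b = F a b)
    (source_id : ∀ a b, F a b * E a = F a b)
    (arrows_zero : ∀ a b c d, O a b → O c d → F a b * F c d = 0) :
    ∃ f : PathAlgebra k O →ₐ[k] C,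
      (∀ a, f (e k O a) = E a) ∧ ∀ a b, O a b → f (x k O a b) = F a b := by
  let g : FreeAlgebra k (OrGen O) →ₐ[k] C :=
    FreeAlgebra.lift k (Sum.elim E fun p => F p.1.1 p.1.2)
  have hge (a : V) : g (FreeAlgebra.ι k (Sum.inl a : OrGen O)) = E a :=
    FreeAlgebra.lift_ι_apply _ _
  have hgx (p) : g (FreeAlgebra.ι k (Sum.inr p : OrGen O)) = F p.1.1 p.1.2 :=
    FreeAlgebra.lift_ι_apply _ _
  have hmul {y z : FreeAlgebra k (OrGen O)} {c d : C} (hy : g y = c) (hz : g z = d) :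
      g (y * z) = c * d := by rw [map_mul, hy, hz]
  have hg : ∀ ⦃y z⦄, OrRel k O y z → g y = g z := by
    intro y z h
    cases h with
    | idem a => exact (hmul (hge a) (hge a)).trans ((idem a).trans (hge a).symm)
    | orth a b h => exact (hmul (hge a) (hge b)).trans ((orth a b h).trans (map_zero g).symm)
    | sum_one => simp only [map_sum, hge, sum_one, map_one]
    | target_id h =>
      exact (hmul (hge _) (hgx _)).trans ((target_id _ _).trans (hgx ⟨_, h⟩).symm)
    | source_id h =>
      exact (hmul (hgx _) (hge _)).trans ((source_id _ _).trans (hgx ⟨_, h⟩).symm)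
    | arrows_zero p q =>
      exact (hmul (hgx p) (hgx q)).trans
        ((arrows_zero _ _ _ _ p.2 q.2).trans (map_zero g).symm)
  refine ⟨RingQuot.liftAlgHom k ⟨g, hg⟩, fun a => ?_, fun a b h => ?_⟩
  · rw [e, RingQuot.liftAlgHom_mkAlgHom_apply, hge]
  · rw [x_of_arrow h, RingQuot.liftAlgHom_mkAlgHom_apply, hgx]

end PathAlgebra

/-! ### Indecomposable modules and change of rings -/

/-- An idempotent endomorphism of an indecomposable module is zero or the identity. -/
theorem IsIndecomposableModule.eq_zero_or_eq_self {R M : Type} [Ring R] [AddCommGroup M]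
    [Module R M] (h : IsIndecomposableModule R M) (p : M →ₗ[R] M) (hp : ∀ n, p (p n) = p n) :
    (∀ n, p n = 0) ∨ ∀ n, p n = n := by
  have hid : IsIdempotentElem p := LinearMap.ext hp
  obtain h | h := h.2 _ _ (LinearMap.IsIdempotentElem.isCompl hid)
  · right
    intro n
    obtain ⟨m, rfl⟩ : n ∈ LinearMap.range p := h ▸ Submodule.mem_top
    exact hp m
  · left
    intro n
    have : n ∈ LinearMap.ker p := h ▸ Submodule.mem_top
    simpa using this

section ChangeOfRings

variable {R Q M : Type} [Ring R] [Ring Q] [AddCommGroup M] [Module R M] [Module Q M]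

/-- If `R` and `Q` act on `M` through the same endomorphisms, submodules are the same. -/
def submoduleOrderIsoOfActions (h : ∀ r : R, ∃ q : Q, ∀ m : M, q • m = r • m)
    (h' : ∀ q : Q, ∃ r : R, ∀ m : M, r • m = q • m) : Submodule R M ≃o Submodule Q M where
  toFun N := { N.toAddSubmonoid with
    smul_mem' := fun q m hm => by
      obtain ⟨r, hr⟩ := h' q
      rw [← hr]
      exact N.smul_mem r hm }
  invFun N := { N.toAddSubmonoid with
    smul_mem' := fun r m hm => by
      obtain ⟨q, hq⟩ := h r
      rw [← hq]
      exact N.smul_mem q hm }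
  left_inv _ := rfl
  right_inv _ := rfl
  map_rel_iff' := Iff.rfl

theorem IsIndecomposableModule.of_actions (h : ∀ r : R, ∃ q : Q, ∀ m : M, q • m = r • m)
    (h' : ∀ q : Q, ∃ r : R, ∀ m : M, r • m = q • m) (hM : IsIndecomposableModule R M) :
    IsIndecomposableModule Q M := by
  refine ⟨hM.1, fun N₁ N₂ hN => ?_⟩
  let φ := (submoduleOrderIsoOfActions h h').symm
  simpa [φ] using hM.2 (φ N₁) (φ N₂) (φ.isCompl hN)

theorem Module.Finite.of_actions (h : ∀ r : R, ∃ q : Q, ∀ m : M, q • m = r • m)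
    [Module.Finite R M] : Module.Finite Q M := by
  obtain ⟨S, hS⟩ := Module.Finite.fg_top (R := R) (M := M)
  refine ⟨S, eq_top_iff.2 fun m _ => ?_⟩
  have hm : m ∈ Submodule.span R (S : Set M) := hS ▸ Submodule.mem_top
  induction hm using Submodule.span_induction with
  | mem x hx => exact Submodule.subset_span hx
  | zero => exact zero_mem _
  | add x y _ _ hx hy => exact add_mem (hx trivial) (hy trivial)
  | smul r x _ hx =>
    obtain ⟨q, hq⟩ := h r
    rw [← hq]
    exact Submodule.smul_mem _ _ (hx trivial)

end ChangeOfRings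

/-- Restriction along a split surjection embeds the indecomposable classes of the quotient ring
into those of the ring; the image consists of the modules inflated from the quotient. -/
theorem exists_inflation {R Q : Type} [Ring R] [Ring Q] (f : R →+* Q) (s : Q →+* R)
    (hfs : ∀ q, f (s q) = q) :
    ∃ i : IndecClasses Q → IndecClasses R, Function.Injective i ∧
      ∀ M : {M : ModRep R // Module.Finite R M.carrier ∧ IsIndecomposableModule R M.carrier},
        Quotient.mk (isoSetoid R) M ∈ Set.range i ↔
          ∀ (r : R) (m : M.1.carrier), s (f r) • m = r • m := by
  let res (N : {N : ModRep Q // Module.Finite Q N.carrier ∧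
      IsIndecomposableModule Q N.carrier}) :
      {M : ModRep R // Module.Finite R M.carrier ∧ IsIndecomposableModule R M.carrier} :=
    letI : Module R N.1.carrier := Module.compHom _ f
    have h (q : Q) : ∃ r : R, ∀ m : N.1.carrier, r • m = q • m :=
      ⟨s q, fun m => (congrArg (· • m) (hfs q) : f (s q) • m = q • m)⟩
    have h' (r : R) : ∃ q : Q, ∀ m : N.1.carrier, q • m = r • m := ⟨f r, fun _ => rfl⟩
    have := N.2.1
    ⟨⟨N.1.carrier⟩, .of_actions h, .of_actions h h' N.2.2⟩
  have res_smul (N) (r : R) (n : N.1.carrier) :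
      (show N.1.carrier from r • (show (res N).1.carrier from n)) = f r • n := rfl
  let i : IndecClasses Q → IndecClasses R := Quotient.map res fun N N' ⟨φ⟩ =>
    ⟨{ (φ : N.1.carrier ≃+ N'.1.carrier) with
        map_smul' := fun r n => φ.map_smul (f r) n }⟩
  refine ⟨i, ?_, fun M => ⟨?_, fun hM => ?_⟩⟩
  · rintro ⟨N⟩ ⟨N'⟩ h
    obtain ⟨φ⟩ := Quotient.exact h
    refine Quotient.sound ⟨{ (φ : N.1.carrier ≃+ N'.1.carrier) with
      map_smul' := fun q n => ?_ }⟩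
    have := φ.map_smul (s q) n
    change φ (f (s q) • n) = f (s q) • φ n at this
    rwa [hfs] at this
  · rintro ⟨⟨N⟩, h⟩ r m
    obtain ⟨φ⟩ := Quotient.exact h
    apply φ.symm.injective
    rw [map_smul, map_smul]
    change f (s (f r)) • (show N.1.carrier from φ.symm m) =
      f r • (show N.1.carrier from φ.symm m)
    rw [hfs]
  · let : Module Q M.1.carrier := Module.compHom _ s
    have h (r : R) : ∃ q : Q, ∀ m : M.1.carrier, q • m = r • m := ⟨f r, hM r⟩
    have h' (q : Q) : ∃ r : R, ∀ m : M.1.carrier, r • m = q • m := ⟨s q, fun _ => rfl⟩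
    have := M.2.1
    refine ⟨Quotient.mk _ ⟨⟨M.1.carrier⟩, .of_actions h, .of_actions h h' M.2.2⟩,
      Quotient.sound ⟨{ AddEquiv.refl M.1.carrier with map_smul' := fun r m => ?_ }⟩⟩
    exact hM r m

/-- If two subsets covering the complement of a copy of `V` meet in a copy of `V`, then the
ambient type is in bijection with their disjoint union. -/
theorem nonempty_equiv_sum_of_range {V : Type*} {X Y Z : Type*} (i : Y → X) (j : Z → X)
    (S P : V → X) (hi : Function.Injective i) (hj : Function.Injective j)
    (hS : Function.Injective S) (hP : Function.Injective P)
    (hinter : Set.range i ∩ Set.range j = Set.range S)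
    (hunion : Set.range i ∪ Set.range j = (Set.range P)ᶜ) : Nonempty (X ≃ Y ⊕ Z) := by
  classical
  have hSi (v) : S v ∈ Set.range i := (hinter.symm.subset ⟨v, rfl⟩).1
  have hSj (v) : S v ∈ Set.range j := (hinter.symm.subset ⟨v, rfl⟩).2
  have hPi (v) (y) : i y ≠ P v := fun h => hunion.subset (.inl ⟨y, rfl⟩) ⟨v, h.symm⟩
  have hPj (v) (z) : j z ≠ P v := fun h => hunion.subset (.inr ⟨z, rfl⟩) ⟨v, h.symm⟩
  have hmem (z) : j z ∈ Set.range i → ∃ v, S v = j z := fun h => hinter.subset ⟨h, z, rfl⟩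
  choose v hv using hmem
  let F : Y ⊕ Z → X := Sum.elim i fun z => if h : j z ∈ Set.range i then P (v z h) else j z
  have hF : Function.Bijective F := by
    constructor
    · rintro (y | z) (y' | z') h
      · exact congrArg _ (hi h)
      · simp only [F, Sum.elim_inl, Sum.elim_inr] at h
        split_ifs at h with h₁
        · exact (hPi _ _ h).elim
        · exact (h₁ ⟨y, h⟩).elim
      · simp only [F, Sum.elim_inl, Sum.elim_inr] at h
        split_ifs at h with h₁
        · exact (hPi _ _ h.symm).elim
        · exact (h₁ ⟨y', h.symm⟩).elim
      · simp only [F, Sum.elim_inr] at h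
        split_ifs at h with h₁ h₂ h₂
        · exact congrArg _ (hj (by rw [← hv z h₁, ← hv z' h₂, hP h]))
        · exact (hPj _ _ h.symm).elim
        · exact (hPj _ _ h).elim
        · exact congrArg _ (hj h)
    · intro w
      by_cases hw : w ∈ Set.range P
      · obtain ⟨a, rfl⟩ := hw
        obtain ⟨z, hz⟩ := hSj a
        have h : j z ∈ Set.range i := hz ▸ hSi a
        refine ⟨.inr z, ?_⟩
        simp only [F, Sum.elim_inr, dif_pos h]
        rw [hS ((hv z h).trans hz)]
      · by_cases hi' : w ∈ Set.range i
        · obtain ⟨y, rfl⟩ := hi'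
          exact ⟨.inl y, rfl⟩
        · obtain h | ⟨z, rfl⟩ := hunion.symm.subset hw
          · exact (hi' h).elim
          · exact ⟨.inr z, dif_neg hi'⟩
  exact ⟨(Equiv.ofBijective F hF).symm⟩

/-! ### Modules over the zigzag algebra -/

namespace ZigzagAlgebra

section Modules

variable {V : Type} [Fintype V] {G : SimpleGraph V}
variable {M N P : Type} [AddCommGroup M] [AddCommGroup N] [AddCommGroup P]
  [Module (ZigzagAlgebra ℂ G) M] [Module (ZigzagAlgebra ℂ G) N] [Module (ZigzagAlgebra ℂ G) P]

theorem sum_e_smul (n : M) : ∑ a, e ℂ G a • n = n := by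
  rw [← Finset.sum_smul, sum_e, one_smul]

theorem e_smul_eq_zero_of_ne {a b : V} (hab : b ≠ a) (ha : ∀ n : M, e ℂ G a • n = n) (n : M) :
    e ℂ G b • n = 0 := by
  rw [← ha n, ← mul_smul, e_mul_e_of_ne hab, zero_smul]

variable [Module ℂ M] [Module ℂ N] [Module ℂ P] [IsScalarTower ℂ (ZigzagAlgebra ℂ G) M]

/-- The map into the principal projective at `a` determined by the functional `φ`, followed by
the map from that projective which sends its generator to `m`. -/
def throughProjective (a : V) (φ : M →ₗ[ℂ] ℂ) (m : N) : M →ₗ[ℂ] N :=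
  (φ ∘ₗ Algebra.lsmul ℂ ℂ M (loop ℂ G a)).smulRight m +
    ∑ b, (φ ∘ₗ Algebra.lsmul ℂ ℂ M (x ℂ G b a)).smulRight (x ℂ G a b • m) +
    (φ ∘ₗ Algebra.lsmul ℂ ℂ M (e ℂ G a)).smulRight (loop ℂ G a • m)

theorem throughProjective_apply (a : V) (φ : M →ₗ[ℂ] ℂ) (m : N) (n : M) :
    throughProjective (G := G) a φ m n = φ (loop ℂ G a • n) • m +
      ∑ b, φ (x ℂ G b a • n) • x ℂ G a b • m + φ (e ℂ G a • n) • loop ℂ G a • m := by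
  simp [throughProjective]

variable [IsScalarTower ℂ (ZigzagAlgebra ℂ G) N] [IsScalarTower ℂ (ZigzagAlgebra ℂ G) P]

/-- A complex linear map commuting with the generators is linear over the zigzag algebra. -/
def linearMapOfGenerators (f : M →ₗ[ℂ] N) (he : ∀ a n, f (e ℂ G a • n) = e ℂ G a • f n)
    (hx : ∀ a b n, f (x ℂ G a b • n) = x ℂ G a b • f n) : M →ₗ[ZigzagAlgebra ℂ G] N where
  toFun := f
  map_add' := f.map_add
  map_smul' y := by
    refine induction (P := fun y => ∀ n, f (y • n) = y • f n) (fun c n => ?_) he hx ?_ ?_ y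
    · simp
    · intro y z hy hz n
      rw [mul_smul, hy, hz, mul_smul]
    · intro y z hy hz n
      rw [add_smul, map_add, hy, hz, add_smul]

@[simp]
theorem linearMapOfGenerators_apply (f : M →ₗ[ℂ] N) (he hx) (n : M) :
    linearMapOfGenerators (G := G) f he hx n = f n := rfl

/-! #### Modules on which all arrows vanish -/

/-- On an indecomposable module without arrows one of the vertex idempotents is the identity. -/
theorem exists_e_smul_eq_self (hM : IsIndecomposableModule (ZigzagAlgebra ℂ G) M)
    (hx : ∀ a b (n : M), x ℂ G a b • n = 0) : ∃ a, ∀ n : M, e ℂ G a • n = n := by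
  classical
  by_contra! hne
  have hzero : ∀ a, ∀ n : M, e ℂ G a • n = 0 := by
    intro a
    let p : M →ₗ[ZigzagAlgebra ℂ G] M :=
      linearMapOfGenerators (Algebra.lsmul ℂ ℂ M (e ℂ G a))
        (fun b n => by
          obtain rfl | hab := eq_or_ne a b
          · rfl
          · simp [← mul_smul, e_mul_e_of_ne hab, e_mul_e_of_ne hab.symm])
        (fun b c n => by simp [hx])
    obtain h | h := hM.eq_zero_or_eq_self p (fun n => by simp [p, ← mul_smul, e_mul_self])
    · exact h
    · obtain ⟨n, hn⟩ := hne a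
      exact (hn (h n)).elim
  have := hM.1
  obtain ⟨n, hn⟩ := exists_ne (0 : M)
  apply hn
  rw [← sum_e_smul (G := G) n]
  simp [hzero]

/-- A complex linear map between modules supported at `a`, with zero arrows, is linear. -/
def linearMapOfSimple {a : V} (hxM : ∀ b c (n : M), x ℂ G b c • n = 0)
    (hxN : ∀ b c (n : N), x ℂ G b c • n = 0) (haM : ∀ n : M, e ℂ G a • n = n)
    (haN : ∀ n : N, e ℂ G a • n = n) (f : M →ₗ[ℂ] N) : M →ₗ[ZigzagAlgebra ℂ G] N :=
  linearMapOfGenerators f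
    (fun b n => by
      obtain rfl | hb := eq_or_ne b a
      · rw [haM, haN]
      · rw [e_smul_eq_zero_of_ne hb haM, e_smul_eq_zero_of_ne hb haN, map_zero])
    (fun b c n => by rw [hxM, hxN, map_zero])

theorem exists_eq_smul_of_simple {a : V} (hM : IsIndecomposableModule (ZigzagAlgebra ℂ G) M)
    (hxM : ∀ b c (n : M), x ℂ G b c • n = 0) (haM : ∀ n : M, e ℂ G a • n = n) :
    ∃ (m : M) (φ : M →ₗ[ℂ] ℂ), φ m = 1 ∧ ∀ n, n = φ n • m := by
  have := hM.1
  obtain ⟨m, hm⟩ := exists_ne (0 : M)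
  obtain ⟨φ, hφ⟩ := Module.Projective.exists_dual_eq_one ℂ hm
  let p := linearMapOfSimple hxM hxM haM haM (φ.smulRight m)
  have hp (n) : p n = φ n • m := rfl
  obtain h | h := hM.eq_zero_or_eq_self p (fun n => by simp [hp, hφ])
  · exact (hm (by simpa [hp, hφ] using h m)).elim
  · exact ⟨m, φ, hφ, fun n => (h n).symm⟩

/-- Two indecomposable modules without arrows, supported at the same vertex, are isomorphic. -/
theorem nonempty_linearEquiv_of_simple {a : V}
    (hM : IsIndecomposableModule (ZigzagAlgebra ℂ G) M)
    (hN : IsIndecomposableModule (ZigzagAlgebra ℂ G) N)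
    (hxM : ∀ b c (n : M), x ℂ G b c • n = 0) (hxN : ∀ b c (n : N), x ℂ G b c • n = 0)
    (haM : ∀ n : M, e ℂ G a • n = n) (haN : ∀ n : N, e ℂ G a • n = n) :
    Nonempty (M ≃ₗ[ZigzagAlgebra ℂ G] N) := by
  obtain ⟨m, φ, hφ, hm⟩ := exists_eq_smul_of_simple hM hxM haM
  obtain ⟨m', φ', hφ', hm'⟩ := exists_eq_smul_of_simple hN hxN haN
  refine ⟨LinearEquiv.ofLinearMap (linearMapOfSimple hxM hxN haM haN (φ.smulRight m'))
    (linearMapOfSimple hxN hxM haN haM (φ'.smulRight m)) ?_ ?_⟩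
  · ext n
    simpa [linearMapOfSimple, hφ] using (hm' n).symm
  · ext n
    simpa [linearMapOfSimple, hφ'] using (hm n).symm

/-! #### Modules on which some loop does not vanish -/

/-- `throughProjective` as a linear map over the zigzag algebra. -/
def throughProjectiveLinear (hG : G.Connected) (hcard : 2 < Fintype.card V) (a : V)
    (φ : M →ₗ[ℂ] ℂ) (m : N) (hm : e ℂ G a • m = m) : M →ₗ[ZigzagAlgebra ℂ G] N :=
  have := IsScalarTower.to_smulCommClass' (R := ℂ) (A := ZigzagAlgebra ℂ G) (M := N)
  linearMapOfGenerators (throughProjective (G := G) a φ m)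
    (fun c n => by
      classical
      simp only [throughProjective_apply, smul_add, Finset.smul_sum,
        smul_comm (_ : ZigzagAlgebra ℂ G) (_ : ℂ), ← mul_smul (_ : ZigzagAlgebra ℂ G)]
      congr 1
      · congr 1
        · obtain rfl | h := eq_or_ne c a
          · rw [loop_mul_e, hm]
          · rw [loop_mul_e_of_ne h.symm, ← hm, ← mul_smul, e_mul_e_of_ne h]
            simp
        · refine Finset.sum_congr rfl fun b _ => ?_
          obtain rfl | h := eq_or_ne c b
          · rw [x_mul_e, e_mul_x]
          · rw [x_mul_e_of_ne h.symm, e_mul_x_of_ne h]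
            simp
      · obtain rfl | h := eq_or_ne c a
        · rw [e_mul_self, e_mul_loop]
        · rw [e_mul_e_of_ne h.symm, e_mul_loop_of_ne h]
          simp)
    (fun c d n => by
      classical
      simp only [throughProjective_apply, smul_add, Finset.smul_sum,
        smul_comm (_ : ZigzagAlgebra ℂ G) (_ : ℂ), ← mul_smul (_ : ZigzagAlgebra ℂ G),
        loop_mul_x hG hcard, x_mul_loop hG hcard, zero_smul,
        map_zero, smul_zero, zero_add, add_zero]
      have h₁ : ∑ b, φ ((x ℂ G b a * x ℂ G c d) • n) • x ℂ G a b • m =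
          φ (loop ℂ G a • n) • x ℂ G c d • m := by
        rw [Finset.sum_eq_single d]
        · obtain rfl | h := eq_or_ne c a
          · by_cases hcd : G.Adj c d
            · rw [x_mul_x_eq_loop hcd]
            · simp [x_of_not_adj hcd]
          · rw [x_mul_x_of_ne h.symm, ← hm, ← mul_smul (x ℂ G c d), x_mul_e_of_ne h]
            simp
        · intro b _ hb
          rw [x_mul_x_of_ne_mid hb]
          simp
        · simp
      have h₂ : ∑ b, φ (x ℂ G b a • n) • (x ℂ G c d * x ℂ G a b) • m =
          φ ((e ℂ G a * x ℂ G c d) • n) • loop ℂ G a • m := by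
        rw [Finset.sum_eq_single c]
        · obtain rfl | h := eq_or_ne d a
          · rw [e_mul_x]
            by_cases hcd : G.Adj c d
            · rw [x_mul_x_eq_loop hcd.symm]
            · simp [x_of_not_adj hcd]
          · rw [x_mul_x_of_ne h, e_mul_x_of_ne h.symm]
            simp
        · intro b _ hb
          rw [x_mul_x_of_ne_mid hb.symm]
          simp
        · simp
      rw [h₁, h₂])

theorem throughProjectiveLinear_apply (hG : G.Connected) (hcard : 2 < Fintype.card V) (a : V)
    (φ : M →ₗ[ℂ] ℂ) (m : N) (hm : e ℂ G a • m = m) (n : M) :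
    throughProjectiveLinear hG hcard a φ m hm n = φ (loop ℂ G a • n) • m +
      ∑ b, φ (x ℂ G b a • n) • x ℂ G a b • m + φ (e ℂ G a • n) • loop ℂ G a • m :=
  throughProjective_apply a φ m n

theorem throughProjectiveLinear_self (hG : G.Connected) (hcard : 2 < Fintype.card V) {a : V}
    {φ : M →ₗ[ℂ] ℂ} {m : M} {m' : N} (hm : e ℂ G a • m = m) (hm' : e ℂ G a • m' = m')
    (hφ : φ (loop ℂ G a • m) = 1) (hφm : φ m = 0) :
    throughProjectiveLinear hG hcard a φ m' hm' m = m' := by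
  have h (b) : φ (x ℂ G b a • m) • x ℂ G a b • m' = 0 := by
    obtain rfl | hb := eq_or_ne b a
    · rw [x_of_not_adj (G.loopless.irrefl b)]
      simp
    · rw [← hm, ← mul_smul, x_mul_e_of_ne hb]
      simp
  rw [throughProjectiveLinear_apply, Finset.sum_eq_zero fun b _ => h b, hm, hφ, hφm]
  simp

theorem map_throughProjectiveLinear (hG : G.Connected) (hcard : 2 < Fintype.card V) {a : V}
    {φ : P →ₗ[ℂ] ℂ} {m : M} {m' : N} (hm : e ℂ G a • m = m) (hm' : e ℂ G a • m' = m')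
    (f : M →ₗ[ZigzagAlgebra ℂ G] N) (hf : f m = m') (n : P) :
    f (throughProjectiveLinear hG hcard a φ m hm n) =
      throughProjectiveLinear hG hcard a φ m' hm' n := by
  have hs (c : ℂ) (n : M) : f (c • n) = c • f n := by
    rw [← algebraMap_smul (ZigzagAlgebra ℂ G) c n, map_smul, algebraMap_smul]
  simp [throughProjectiveLinear_apply, hs, hf]

/-- If the loop at `a` acts nontrivially, some functional detects it on a vector at `a`. -/
theorem exists_dual_loop_smul_eq_one (hG : G.Connected) (hcard : 2 < Fintype.card V) {a : V}
    {n : M} (hn : loop ℂ G a • n ≠ 0) : ∃ (m : M) (φ : M →ₗ[ℂ] ℂ),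
      e ℂ G a • m = m ∧ φ (loop ℂ G a • m) = 1 ∧ φ m = 0 := by
  have := IsScalarTower.to_smulCommClass' (R := ℂ) (A := ZigzagAlgebra ℂ G) (M := M)
  obtain ⟨φ, hφ⟩ := Module.Projective.exists_dual_eq_one ℂ hn
  refine ⟨e ℂ G a • n - φ (e ℂ G a • n) • loop ℂ G a • n, φ, ?_, ?_, ?_⟩
  · simp [smul_sub, smul_comm (_ : ZigzagAlgebra ℂ G) (_ : ℂ),
      ← mul_smul (_ : ZigzagAlgebra ℂ G), e_mul_self, e_mul_loop]
  · simp [smul_sub, smul_comm (_ : ZigzagAlgebra ℂ G) (_ : ℂ),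
      ← mul_smul (_ : ZigzagAlgebra ℂ G), loop_mul_loop hG hcard, loop_mul_e, hφ]
  · simp [hφ]

/-- An indecomposable module on which the loop at `a` acts nontrivially is a copy of the
principal projective at `a`. -/
theorem exists_throughProjectiveLinear_eq_self (hG : G.Connected) (hcard : 2 < Fintype.card V)
    {a : V} (hM : IsIndecomposableModule (ZigzagAlgebra ℂ G) M)
    (ha : ∃ n : M, loop ℂ G a • n ≠ 0) : ∃ (m : M) (φ : M →ₗ[ℂ] ℂ) (hm : e ℂ G a • m = m),
      φ (loop ℂ G a • m) = 1 ∧ φ m = 0 ∧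
        ∀ n, throughProjectiveLinear hG hcard a φ m hm n = n := by
  obtain ⟨n, hn⟩ := ha
  obtain ⟨m, φ, hm, hφ, hφm⟩ := exists_dual_loop_smul_eq_one hG hcard hn
  let p := throughProjectiveLinear hG hcard a φ m hm
  have hpm : p m = m := throughProjectiveLinear_self hG hcard hm hm hφ hφm
  refine ⟨m, φ, hm, hφ, hφm, ?_⟩
  obtain h | h := hM.eq_zero_or_eq_self p (map_throughProjectiveLinear hG hcard hm hm p hpm)
  · rw [← hpm, h m] at hφ
    simp at hφ
  · exact h

theorem nonempty_linearEquiv_of_loop_smul_ne_zero (hG : G.Connected)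
    (hcard : 2 < Fintype.card V) {a : V} (hM : IsIndecomposableModule (ZigzagAlgebra ℂ G) M)
    (hN : IsIndecomposableModule (ZigzagAlgebra ℂ G) N) (haM : ∃ n : M, loop ℂ G a • n ≠ 0)
    (haN : ∃ n : N, loop ℂ G a • n ≠ 0) : Nonempty (M ≃ₗ[ZigzagAlgebra ℂ G] N) := by
  obtain ⟨m, φ, hm, hφ, hφm, hp⟩ := exists_throughProjectiveLinear_eq_self hG hcard hM haM
  obtain ⟨m', φ', hm', hφ', hφm', hp'⟩ := exists_throughProjectiveLinear_eq_self hG hcard hN haN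
  refine ⟨LinearEquiv.ofLinearMap (throughProjectiveLinear hG hcard a φ m' hm')
    (throughProjectiveLinear hG hcard a φ' m hm) ?_ ?_⟩
  · ext n
    rw [LinearMap.comp_apply, map_throughProjectiveLinear hG hcard hm hm' _
      (throughProjectiveLinear_self hG hcard hm hm' hφ hφm), hp', LinearMap.id_apply]
  · ext n
    rw [LinearMap.comp_apply, map_throughProjectiveLinear hG hcard hm' hm _
      (throughProjectiveLinear_self hG hcard hm' hm hφ' hφm'), hp, LinearMap.id_apply]

/-- At most one loop acts nontrivially on an indecomposable module. -/
theorem eq_of_loop_smul_ne_zero (hG : G.Connected) (hcard : 2 < Fintype.card V) {a b : V}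
    (hM : IsIndecomposableModule (ZigzagAlgebra ℂ G) M) (ha : ∃ n : M, loop ℂ G a • n ≠ 0)
    (hb : ∃ n : M, loop ℂ G b • n ≠ 0) : a = b := by
  have := IsScalarTower.to_smulCommClass' (R := ℂ) (A := ZigzagAlgebra ℂ G) (M := M)
  obtain ⟨m, φ, hm, -, -, hp⟩ := exists_throughProjectiveLinear_eq_self hG hcard hM ha
  obtain ⟨n, hn⟩ := hb
  by_contra hab
  apply hn
  rw [← hp n, throughProjectiveLinear_apply]
  nth_rw 1 [← hm]
  simp [Finset.smul_sum, smul_comm (_ : ZigzagAlgebra ℂ G) (_ : ℂ),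
    ← mul_smul (_ : ZigzagAlgebra ℂ G), loop_mul_x hG hcard, loop_mul_loop hG hcard,
    loop_mul_e_of_ne (Ne.symm hab)]

theorem isIndecomposableModule_of_throughProjectiveLinear (hG : G.Connected)
    (hcard : 2 < Fintype.card V) {a : V} (m : M) (φ : M →ₗ[ℂ] ℂ) (hm : e ℂ G a • m = m)
    (hφ : φ (loop ℂ G a • m) = 1)
    (hp : ∀ n, throughProjectiveLinear hG hcard a φ m hm n = n) :
    IsIndecomposableModule (ZigzagAlgebra ℂ G) M := by
  have hcomm := IsScalarTower.to_smulCommClass' (R := ℂ) (A := ZigzagAlgebra ℂ G) (M := M)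
  have hsmul (N : Submodule (ZigzagAlgebra ℂ G) M) (c : ℂ) (n : M) (hn : n ∈ N) : c • n ∈ N := by
    rw [← algebraMap_smul (ZigzagAlgebra ℂ G) c n]
    exact N.smul_mem _ hn
  have htop (N : Submodule (ZigzagAlgebra ℂ G) M) (hN : m ∈ N) : N = ⊤ := by
    refine eq_top_iff.2 fun n _ => ?_
    rw [← hp n, throughProjectiveLinear_apply]
    exact N.add_mem (N.add_mem (hsmul _ _ _ hN) (N.sum_mem fun b _ =>
      hsmul _ _ _ (N.smul_mem _ hN))) (hsmul _ _ _ (N.smul_mem _ hN))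
  have key (N : Submodule (ZigzagAlgebra ℂ G) M) (n : M) (hn : n ∈ N)
      (hφn : φ (loop ℂ G a • n) ≠ 0) : N = ⊤ := by
    have hx (b : V) : e ℂ G a * x ℂ G a b = 0 := by
      obtain rfl | hb := eq_or_ne a b
      · rw [x_of_not_adj (G.loopless.irrefl a), mul_zero]
      · exact e_mul_x_of_ne hb
    have hloop : loop ℂ G a • n = φ (loop ℂ G a • n) • loop ℂ G a • m := by
      conv_lhs => rw [← hp n, throughProjectiveLinear_apply]
      simp [Finset.smul_sum, smul_comm (_ : ZigzagAlgebra ℂ G) (_ : ℂ),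
        ← mul_smul (_ : ZigzagAlgebra ℂ G), loop_mul_x hG hcard, loop_mul_loop hG hcard]
    have he : e ℂ G a • n =
        φ (loop ℂ G a • n) • m + φ (e ℂ G a • n) • loop ℂ G a • m := by
      conv_lhs => rw [← hp n, throughProjectiveLinear_apply]
      simp [Finset.smul_sum, smul_comm (_ : ZigzagAlgebra ℂ G) (_ : ℂ),
        ← mul_smul (_ : ZigzagAlgebra ℂ G), hx, e_mul_loop, hm]
    have hloop_mem : loop ℂ G a • m ∈ N := by
      have := hsmul N (φ (loop ℂ G a • n))⁻¹ _ (N.smul_mem (loop ℂ G a) hn)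
      rwa [hloop, map_smul, hφ, smul_eq_mul, mul_one, inv_smul_smul₀ hφn] at this
    apply htop
    have := hsmul N (φ (loop ℂ G a • n))⁻¹ _ (N.sub_mem (N.smul_mem (e ℂ G a) hn)
      (hsmul N (φ (e ℂ G a • n)) _ hloop_mem))
    rwa [sub_eq_of_eq_add he, inv_smul_smul₀ hφn] at this
  refine ⟨⟨m, 0, by rintro rfl; simp at hφ⟩, fun N₁ N₂ hN => ?_⟩
  obtain ⟨n₁, hn₁, n₂, hn₂, hsum⟩ := Submodule.mem_sup.1
    (hN.sup_eq_top ▸ Submodule.mem_top : m ∈ N₁ ⊔ N₂)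
  rw [← hsum, smul_add, map_add] at hφ
  by_cases h : φ (loop ℂ G a • n₁) = 0
  · refine .inr (key N₂ n₂ hn₂ fun h₂ => ?_)
    simp [h, h₂] at hφ
  · exact .inl (key N₁ n₁ hn₁ h)

end Modules

end ZigzagAlgebra

/-! #### Modules on which all loops vanish -/

namespace ZigzagAlgebra

section Decomposition

variable {V : Type} [Fintype V] {G : SimpleGraph V}
variable {M : Type} [AddCommGroup M] [Module (ZigzagAlgebra ℂ G) M]

theorem x_smul_x_smul (hloop : ∀ a (n : M), loop ℂ G a • n = 0) (a b c d : V) (n : M) :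
    x ℂ G c d • x ℂ G a b • n = 0 := by
  rw [← mul_smul]
  obtain rfl | hc := eq_or_ne c b
  · obtain rfl | hd := eq_or_ne d a
    · by_cases h : G.Adj d c
      · rw [x_mul_x_eq_loop h, hloop]
      · rw [x_of_not_adj h, mul_zero, zero_smul]
    · rw [x_mul_x_of_ne hd, zero_smul]
  · rw [x_mul_x_of_ne_mid hc, zero_smul]

variable [Module ℂ M] [IsScalarTower ℂ (ZigzagAlgebra ℂ G) M]

/-- There is a linear projection of the module onto a subspace which contains the images of all
arrows, is annihilated by all arrows, and is stable under the vertex idempotents. -/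
theorem exists_projection_radical (hloop : ∀ a (n : M), loop ℂ G a • n = 0) :
    ∃ π : M →ₗ[ℂ] M, (∀ a b n, x ℂ G a b • π n = 0) ∧
      (∀ a b n, π (x ℂ G a b • n) = x ℂ G a b • n) ∧ (∀ n, π (π n) = π n) ∧
      ∀ a n, π (e ℂ G a • π n) = e ℂ G a • π n := by
  let J : Submodule ℂ M := Submodule.span ℂ {m | ∃ a b, ∃ n : M, m = x ℂ G a b • n}
  have hcomm := IsScalarTower.to_smulCommClass' (R := ℂ) (A := ZigzagAlgebra ℂ G) (M := M)
  have hJx (a b) (j : M) (hj : j ∈ J) : x ℂ G a b • j = 0 := by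
    induction hj using Submodule.span_induction with
    | mem y hy =>
      obtain ⟨c, d, n, rfl⟩ := hy
      exact x_smul_x_smul hloop c d a b n
    | zero => simp
    | add y z _ _ hy hz => simp [hy, hz]
    | smul r y _ hy => rw [smul_comm, hy, smul_zero]
  have hJe (a) (j : M) (hj : j ∈ J) : e ℂ G a • j ∈ J := by
    induction hj using Submodule.span_induction with
    | mem y hy =>
      obtain ⟨c, d, n, rfl⟩ := hy
      rw [← mul_smul]
      obtain rfl | h := eq_or_ne a d
      · rw [e_mul_x]
        exact Submodule.subset_span ⟨c, a, n, rfl⟩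
      · rw [e_mul_x_of_ne h, zero_smul]
        exact J.zero_mem
    | zero => simp
    | add y z _ _ hy hz => simpa using J.add_mem hy hz
    | smul r y _ hy => rw [smul_comm]; exact J.smul_mem _ hy
  obtain ⟨g, hg⟩ := J.subtype.exists_leftInverse_of_injective J.ker_subtype
  have hπ (j : M) (hj : j ∈ J) : (g j : M) = j :=
    congrArg Subtype.val (LinearMap.congr_fun hg ⟨j, hj⟩)
  exact ⟨J.subtype ∘ₗ g, fun a b n => hJx _ _ _ (g n).2,
    fun a b n => hπ _ (Submodule.subset_span ⟨a, b, n, rfl⟩), fun n => hπ _ (g n).2,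
    fun a n => hπ _ (hJe _ _ (g n).2)⟩

open scoped Classical in
/-- On an indecomposable module without loops over a bipartite graph, the arrows starting in one
of the two parts all vanish. -/
theorem x_smul_eq_zero_of_bipartite (hM : IsIndecomposableModule (ZigzagAlgebra ℂ G) M)
    (hloop : ∀ a (n : M), loop ℂ G a • n = 0) (S : Set V)
    (hS : ∀ a b, G.Adj a b → (a ∈ S ↔ b ∉ S)) :
    (∀ a ∈ S, ∀ b, ∀ n : M, x ℂ G a b • n = 0) ∨ ∀ a ∉ S, ∀ b, ∀ n : M, x ℂ G a b • n = 0 := by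
  obtain ⟨π, hxπ, hπx, hππ, hπe⟩ := exists_projection_radical hloop
  let r (a : V) : M →ₗ[ℂ] M := if a ∈ S then LinearMap.id - π else π
  have hr (a : V) (n : M) :
      e ℂ G a • r a (e ℂ G a • r a (e ℂ G a • n)) = e ℂ G a • r a (e ℂ G a • n) := by
    by_cases ha : a ∈ S
    · simp [r, ha, smul_sub, ← mul_smul (_ : ZigzagAlgebra ℂ G), e_mul_self, hπe]
    · simp [r, ha, ← mul_smul (_ : ZigzagAlgebra ℂ G), e_mul_self, hπe]
  let q : M →ₗ[ℂ] M :=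
    ∑ a, Algebra.lsmul ℂ ℂ M (e ℂ G a) ∘ₗ r a ∘ₗ Algebra.lsmul ℂ ℂ M (e ℂ G a)
  have hq (n : M) : q n = ∑ a, e ℂ G a • r a (e ℂ G a • n) := by simp [q]
  have heq (a : V) (n : M) : e ℂ G a • q n = e ℂ G a • r a (e ℂ G a • n) := by
    rw [hq, Finset.smul_sum, Finset.sum_eq_single a]
    · rw [← mul_smul, e_mul_self]
    · intro b _ hb
      rw [← mul_smul, e_mul_e_of_ne hb.symm, zero_smul]
    · simp
  have hqe (a : V) (n : M) : q (e ℂ G a • n) = e ℂ G a • r a (e ℂ G a • n) := by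
    rw [hq, Finset.sum_eq_single a]
    · rw [← mul_smul (e ℂ G a) (e ℂ G a) n, e_mul_self]
    · intro b _ hb
      rw [← mul_smul (e ℂ G b) (e ℂ G a) n, e_mul_e_of_ne hb]
      simp
    · simp
  have hxq (a b : V) (n : M) : x ℂ G a b • q n = if a ∈ S then x ℂ G a b • n else 0 := by
    rw [← x_mul_e, mul_smul, heq, ← mul_smul, x_mul_e]
    split_ifs with ha
    · simp [r, ha, smul_sub, hxπ, ← mul_smul (_ : ZigzagAlgebra ℂ G), x_mul_e]
    · simp [r, ha, hxπ]
  have hqx (a b : V) (n : M) : q (x ℂ G a b • n) = if b ∈ S then 0 else x ℂ G a b • n := by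
    rw [← e_mul_x, mul_smul, hqe, ← mul_smul (e ℂ G b), e_mul_x]
    split_ifs with hb
    · simp [r, hb, hπx]
    · simp [r, hb, hπx, ← mul_smul (_ : ZigzagAlgebra ℂ G), e_mul_x]
  let p : M →ₗ[ZigzagAlgebra ℂ G] M := linearMapOfGenerators q
    (fun a n => by rw [hqe, heq])
    (fun a b n => by
      by_cases hab : G.Adj a b
      · by_cases hb : b ∈ S <;> simp [hxq, hqx, hS a b hab, hb]
      · simp [x_of_not_adj hab])
  have hp (n : M) : p n = q n := rfl
  have hpp (n : M) : p (p n) = p n := by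
    rw [hp, hp, hq (q n), hq n]
    refine Finset.sum_congr rfl fun a _ => ?_
    rw [← hq, heq, hr]
  obtain h | h := hM.eq_zero_or_eq_self p hpp
  · left
    intro a ha b n
    have := hxq a b n
    rw [← hp, h, smul_zero, if_pos ha] at this
    exact this.symm
  · right
    intro a ha b n
    have := hxq a b n
    rwa [← hp, h, if_neg ha] at this

end Decomposition

/-! ### Existence of the simple and the principal projective modules -/

section Existence

variable {V : Type} [Fintype V] [DecidableEq V] {G : SimpleGraph V}

theorem exists_simple (a : V) : ∃ M : {M : ModRep (ZigzagAlgebra ℂ G) //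
      Module.Finite (ZigzagAlgebra ℂ G) M.carrier ∧
        IsIndecomposableModule (ZigzagAlgebra ℂ G) M.carrier},
    (∀ b c (n : M.1.carrier), x ℂ G b c • n = 0) ∧ ∀ n : M.1.carrier, e ℂ G a • n = n := by
  obtain ⟨ε, he, hx⟩ := exists_algHom (k := ℂ) (G := G) (C := ℂ) (fun c => if c = a then 1 else 0)
    (fun _ _ => 0) (by simp) (by intro b c h; simp; grind) (by simp) (by simp) (by simp)
    (by simp) (by simp)
  let _ : Module (ZigzagAlgebra ℂ G) ℂ := Module.compHom ℂ ε.toRingHom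
  have hsmul (y : ZigzagAlgebra ℂ G) (n : ℂ) : y • n = ε y * n := rfl
  have h (c : ℂ) : ∃ y : ZigzagAlgebra ℂ G, ∀ n : ℂ, y • n = c • n :=
    ⟨algebraMap ℂ _ c, fun n => by simp [hsmul]⟩
  have h' (y : ZigzagAlgebra ℂ G) : ∃ c : ℂ, ∀ n : ℂ, c • n = y • n := ⟨ε y, fun _ => rfl⟩
  have hℂ : IsIndecomposableModule ℂ ℂ := by
    refine ⟨inferInstance, fun N₁ N₂ hN => ?_⟩
    obtain rfl | rfl := eq_bot_or_eq_top N₁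
    · exact .inr (by simpa using hN.sup_eq_top)
    · exact .inl rfl
  refine ⟨⟨⟨ℂ⟩, .of_actions h, hℂ.of_actions h h'⟩, fun b c n => ?_, fun n => ?_⟩
  · change ε _ * (n : ℂ) = 0
    by_cases hbc : G.Adj b c
    · rw [hx b c hbc, zero_mul]
    · rw [x_of_not_adj hbc, map_zero, zero_mul]
  · change ε _ * (n : ℂ) = n
    rw [he, if_pos rfl, one_mul]

theorem loop_ne_zero {a b : V} (hab : G.Adj a b) : loop ℂ G a ≠ 0 := by
  let E (c : V) : Module.End ℂ (ℂ × (V → ℂ) × ℂ) :=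
    { toFun w := (if c = a then w.1 else 0, Pi.single c (w.2.1 c), if c = a then w.2.2 else 0)
      map_add' w w' := by split_ifs <;> simp [Pi.single_add]
      map_smul' r w := by split_ifs <;> simp [← Pi.single_smul] }
  let F (c d : V) : Module.End ℂ (ℂ × (V → ℂ) × ℂ) :=
    { toFun w := (0, if c = a then Pi.single d w.1 else 0, if d = a then w.2.1 c else 0)
      map_add' w w' := by split_ifs <;> simp [Pi.single_add]
      map_smul' r w := by split_ifs <;> simp [← Pi.single_smul] }
  have hE (c w) : E c w =
    (if c = a then w.1 else 0, Pi.single c (w.2.1 c), if c = a then w.2.2 else 0) := rfl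
  have hF (c d w) : F c d w =
    (0, if c = a then Pi.single d w.1 else 0, if d = a then w.2.1 c else 0) := rfl
  obtain ⟨f, -, hf⟩ := exists_algHom (k := ℂ) (G := G) E F
    (by
      intro c
      refine LinearMap.ext fun w => ?_
      simp only [Module.End.mul_apply, hE, Prod.ext_iff, funext_iff, Pi.single_apply]
      grind)
    (by
      intro c d hcd
      refine LinearMap.ext fun w => ?_
      simp only [Module.End.mul_apply, hE, Prod.ext_iff, funext_iff, Pi.single_apply,
        Pi.zero_apply, LinearMap.zero_apply, Prod.fst_zero, Prod.snd_zero]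
      grind)
    (by
      refine LinearMap.ext fun w => ?_
      simp [hE, LinearMap.sum_apply, Prod.ext_iff, Prod.fst_sum, Prod.snd_sum,
        Finset.univ_sum_single])
    (by
      intro c d
      refine LinearMap.ext fun w => ?_
      simp only [Module.End.mul_apply, hE, hF, Prod.ext_iff, funext_iff, Pi.single_apply,
        ite_apply, Pi.zero_apply]
      grind)
    (by
      intro c d
      refine LinearMap.ext fun w => ?_
      simp only [Module.End.mul_apply, hE, hF, Prod.ext_iff, funext_iff, Pi.single_apply,
        ite_apply, Pi.zero_apply]
      grind)
    (by
      intro b c d hdb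
      refine LinearMap.ext fun w => ?_
      simp only [Module.End.mul_apply, hF, Prod.ext_iff, funext_iff, Pi.single_apply, ite_apply,
        Pi.zero_apply, LinearMap.zero_apply, Prod.fst_zero, Prod.snd_zero]
      grind)
    (by
      intro b c d
      refine LinearMap.ext fun w => ?_
      simp only [Module.End.mul_apply, hF, Prod.ext_iff, funext_iff, Pi.single_apply, ite_apply,
        Pi.zero_apply]
      grind)
  intro h
  have := LinearMap.congr_fun (congrArg f h) (1, 0, 0)
  rw [← x_mul_x_eq_loop hab, map_mul, hf _ _ hab, hf _ _ hab.symm] at this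
  simp [hF] at this

theorem exists_projective (hG : G.Connected) (hcard : 2 < Fintype.card V) (a : V) :
    ∃ M : {M : ModRep (ZigzagAlgebra ℂ G) // Module.Finite (ZigzagAlgebra ℂ G) M.carrier ∧
        IsIndecomposableModule (ZigzagAlgebra ℂ G) M.carrier},
      ∃ n : M.1.carrier, loop ℂ G a • n ≠ 0 := by
  have : Nontrivial V := Fintype.one_lt_card_iff_nontrivial.1 (by omega)
  obtain ⟨b, hab⟩ := hG.preconnected.exists_adj_of_nontrivial a
  obtain ⟨m, φ, hm, hφ, hφm⟩ := exists_dual_loop_smul_eq_one (M := ZigzagAlgebra ℂ G) (n := 1)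
    hG hcard (by simpa using loop_ne_zero hab)
  let N : Submodule (ZigzagAlgebra ℂ G) (ZigzagAlgebra ℂ G) := Submodule.span _ {m}
  let m' : N := ⟨m, Submodule.mem_span_singleton_self m⟩
  let φ' : N →ₗ[ℂ] ℂ := φ ∘ₗ N.subtype.restrictScalars ℂ
  have hm' : e ℂ G a • m' = m' := Subtype.ext hm
  have hφ' : φ' (loop ℂ G a • m') = 1 := hφ
  have hself := throughProjectiveLinear_self (M := N) (N := N) hG hcard hm' hm' hφ' hφm
  refine ⟨⟨⟨N⟩, inferInstance, isIndecomposableModule_of_throughProjectiveLinear hG hcard m' φ'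
    hm' hφ' ?_⟩, m', fun h => ?_⟩
  · rintro ⟨n, hn⟩
    obtain ⟨y, rfl⟩ := Submodule.mem_span_singleton.1 hn
    change throughProjectiveLinear hG hcard a φ' m' hm' (y • m') = y • m'
    rw [map_smul, hself]
  · have h' : loop ℂ G a • m' = 0 := h
    rw [h', map_zero] at hφ'
    exact zero_ne_one hφ'

end Existence

/-! ### Comparison with the path algebras -/

section Inflation

variable {V : Type} [Fintype V] {G : SimpleGraph V}

/-- The modules of the path algebra are the modules of the zigzag algebra on which the arrows
outside the orientation vanish. -/
theorem exists_inflation_pathAlgebra {O : V → V → Prop} (hOadj : ∀ a b, O a b → G.Adj a b)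
    (hsinksource : ∀ a, (∀ b, ¬ O b a) ∨ ∀ b, ¬ O a b) :
    ∃ i : IndecClasses (PathAlgebra ℂ O) → IndecClasses (ZigzagAlgebra ℂ G),
      Function.Injective i ∧ ∀ M, Quotient.mk (isoSetoid (ZigzagAlgebra ℂ G)) M ∈ Set.range i ↔
        ∀ a b, ¬ O a b → ∀ n : M.1.carrier, x ℂ G a b • n = 0 := by
  obtain ⟨f, hfe, hfx⟩ := exists_algHom (k := ℂ) (G := G) (PathAlgebra.e ℂ O)
    (PathAlgebra.x ℂ O) PathAlgebra.e_mul_self (fun _ _ => PathAlgebra.e_mul_e_of_ne)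
    PathAlgebra.sum_e PathAlgebra.e_mul_x PathAlgebra.x_mul_e
    (fun _ _ _ _ => PathAlgebra.x_mul_x _ _ _ _) (by simp [PathAlgebra.x_mul_x])
  obtain ⟨s, hse, hsx⟩ := PathAlgebra.exists_algHom (k := ℂ) (O := O) (e ℂ G) (x ℂ G)
    e_mul_self (fun _ _ => e_mul_e_of_ne) sum_e e_mul_x x_mul_e (fun a b c d hab hcd => by
      refine x_mul_x_of_ne_mid ?_
      rintro rfl
      exact (hsinksource a).elim (fun h => h c hcd) fun h => h b hab)
  have hfs (q : PathAlgebra ℂ O) : f (s q) = q := by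
    induction q using PathAlgebra.induction with
    | halg c => simp
    | he a => rw [hse, hfe]
    | hx a b h => rw [hsx a b h, hfx a b (hOadj a b h)]
    | hmul y z hy hz => rw [map_mul, map_mul, hy, hz]
    | hadd y z hy hz => rw [map_add, map_add, hy, hz]
  have hfx_zero (a b : V) (h : ¬ O a b) : f (x ℂ G a b) = 0 := by
    by_cases hab : G.Adj a b
    · rw [hfx a b hab, PathAlgebra.x_of_not_arrow h]
    · rw [x_of_not_adj hab, map_zero]
  obtain ⟨i, hi, hrange⟩ := exists_inflation f.toRingHom s.toRingHom hfs
  refine ⟨i, hi, fun M => (hrange M).trans ⟨fun h a b hab n => ?_, fun h r => ?_⟩⟩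
  · rw [← h]
    change s (f _) • n = 0
    rw [hfx_zero a b hab, map_zero, zero_smul]
  · change ∀ n : M.1.carrier, s (f r) • n = r • n
    induction r using induction with
    | halg c => simp
    | he a => simp [hfe, hse]
    | hx a b =>
      intro n
      by_cases hab : O a b
      · rw [hfx a b (hOadj a b hab), hsx a b hab]
      · rw [h a b hab, hfx_zero a b hab, map_zero, zero_smul]
    | hmul y z hy hz =>
      intro n
      rw [map_mul, map_mul, mul_smul, hz, hy, mul_smul]
    | hadd y z hy hz =>
      intro n
      rw [map_add, map_add, add_smul, hz, hy, add_smul]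

end Inflation

/-- The complex structure on a module over the zigzag algebra. -/
abbrev complexModule {V : Type} [Fintype V] (G : SimpleGraph V) (M : Type) [AddCommGroup M]
    [Module (ZigzagAlgebra ℂ G) M] : Module ℂ M :=
  Module.compHom M (algebraMap ℂ (ZigzagAlgebra ℂ G))

theorem isScalarTower_complexModule {V : Type} [Fintype V] (G : SimpleGraph V) (M : Type)
    [AddCommGroup M] [Module (ZigzagAlgebra ℂ G) M] :
    letI := complexModule G M
    IsScalarTower ℂ (ZigzagAlgebra ℂ G) M := by
  let _ := complexModule G M
  refine ⟨fun c y n => ?_⟩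
  rw [Algebra.smul_def, mul_smul]
  rfl

end ZigzagAlgebra

/-- let `Γ` be a finite tree with more than two vertices, `Γ⁰` a
sink-source orientation of `Γ` and `Γ¹` the opposite orientation. Then the isomorphism
classes of indecomposable finite-dimensional `A(Γ)`-modules are in bijection with the
disjoint union of the isomorphism classes of indecomposable finite-dimensional
`B(Γ⁰)`-modules and of indecomposable finite-dimensional `B(Γ¹)`-modules; equivalently,
indecomposables of `A(Γ)` correspond two-to-one to indecomposables of `B(Γ⁰)`. -/
theorem zigzag_indecomposables_two_to_one {V : Type} [Fintype V] [DecidableEq V]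
    (G : SimpleGraph V) [DecidableRel G.Adj]
    (htree : G.IsTree) (hcard : 2 < Fintype.card V)
    (O : V → V → Prop)
    (hOadj : ∀ a b : V, O a b → G.Adj a b)
    (hOcover : ∀ a b : V, G.Adj a b → (O a b ∨ O b a))
    (hOanti : ∀ a b : V, ¬ (O a b ∧ O b a))
    (hsinksource : ∀ a : V, (∀ b : V, ¬ O b a) ∨ (∀ b : V, ¬ O a b)) :
    Nonempty
      (IndecClasses (ZigzagAlgebra ℂ G) ≃
        (IndecClasses (PathAlgebra ℂ O) ⊕ IndecClasses (PathAlgebra ℂ (fun a b => O b a)))) := by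
  let A := ZigzagAlgebra ℂ G
  have hG : G.Connected := htree.connected
  let (M : ModRep A) : Module ℂ M.carrier := ZigzagAlgebra.complexModule G M.carrier
  have (M : ModRep A) : IsScalarTower ℂ A M.carrier :=
    ZigzagAlgebra.isScalarTower_complexModule G M.carrier
  obtain ⟨i, hi, hi_range⟩ := ZigzagAlgebra.exists_inflation_pathAlgebra hOadj hsinksource
  obtain ⟨j, hj, hj_range⟩ := ZigzagAlgebra.exists_inflation_pathAlgebra
    (G := G) (O := fun a b => O b a) (fun a b h => (hOadj b a h).symm) fun a => (hsinksource a).symm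
  choose S hSx hSe using ZigzagAlgebra.exists_simple (G := G)
  choose P hP using ZigzagAlgebra.exists_projective hG hcard
  refine nonempty_equiv_sum_of_range i j (fun a => Quotient.mk (isoSetoid A) (S a))
    (fun a => Quotient.mk (isoSetoid A) (P a)) hi hj ?_ ?_ ?_ ?_
  · intro a b h
    obtain ⟨φ⟩ := Quotient.exact h
    by_contra hab
    have := (S a).2.2.1
    obtain ⟨n, hn⟩ := exists_ne (0 : (S a).1.carrier)
    apply hn
    rw [← hSe a n]
    apply φ.injective
    rw [map_smul, map_zero, ZigzagAlgebra.e_smul_eq_zero_of_ne hab (hSe b)]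
  · intro a b h
    obtain ⟨φ⟩ := Quotient.exact h
    refine ZigzagAlgebra.eq_of_loop_smul_ne_zero hG hcard (P a).2.2 (hP a) ?_
    obtain ⟨n, hn⟩ := hP b
    refine ⟨φ.symm n, fun h => hn (φ.symm.injective ?_)⟩
    rw [map_smul, h, map_zero]
  · refine Set.ext fun M => Quotient.inductionOn M fun M => ?_
    refine Iff.trans (and_congr (hi_range M) (hj_range M)) ?_
    constructor
    · rintro ⟨h₁, h₂⟩
      have hx (a b) (n : M.1.carrier) : ZigzagAlgebra.x ℂ G a b • n = 0 := by
        by_cases hab : O a b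
        · exact h₂ a b (fun h => hOanti a b ⟨hab, h⟩) n
        · exact h₁ a b hab n
      obtain ⟨a, ha⟩ := ZigzagAlgebra.exists_e_smul_eq_self M.2.2 hx
      exact ⟨a, Quotient.sound (ZigzagAlgebra.nonempty_linearEquiv_of_simple (S a).2.2 M.2.2
        (hSx a) hx (hSe a) ha)⟩
    · rintro ⟨a, ha⟩
      obtain ⟨φ⟩ := Quotient.exact ha
      have hx (b c) (n : M.1.carrier) : ZigzagAlgebra.x ℂ G b c • n = 0 := by
        apply φ.symm.injective
        rw [map_smul, hSx, map_zero]
      exact ⟨fun b c _ => hx b c, fun b c _ => hx b c⟩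
  · refine Set.ext fun M => Quotient.inductionOn M fun M => ?_
    refine Iff.trans (or_congr (hi_range M) (hj_range M)) ?_
    constructor
    · rintro h ⟨a, ha⟩
      obtain ⟨φ⟩ := Quotient.exact ha
      obtain ⟨n, hn⟩ := hP a
      refine hn (φ.injective ?_)
      rw [map_smul, map_zero]
      by_cases hex : ∃ b, G.Adj a b
      · obtain ⟨b, hab⟩ := hex
        rw [← ZigzagAlgebra.x_mul_x_eq_loop hab, mul_smul]
        obtain h | h := h <;> obtain hO | hO := not_and_or.1 (hOanti a b)
        · rw [h a b hO, smul_zero]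
        · rw [h b a hO]
        · rw [h b a hO]
        · rw [h a b hO, smul_zero]
      · rw [ZigzagAlgebra.loop_of_forall_not_adj (not_exists.1 hex), zero_smul]
    · intro hM
      have hloop (a) (n : M.1.carrier) : ZigzagAlgebra.loop ℂ G a • n = 0 := by
        by_contra hn
        exact hM ⟨a, Quotient.sound (ZigzagAlgebra.nonempty_linearEquiv_of_loop_smul_ne_zero
          hG hcard (P a).2.2 M.2.2 (hP a) ⟨n, hn⟩)⟩
      have hsource {a b} (h : O a b) : a ∈ {c | ∃ d, O c d} ∧ b ∉ {c | ∃ d, O c d} :=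
        ⟨⟨b, h⟩, fun ⟨c, hc⟩ => (hsinksource b).elim (fun h' => h' a h) fun h' => h' c hc⟩
      obtain h | h := ZigzagAlgebra.x_smul_eq_zero_of_bipartite M.2.2 hloop {c | ∃ d, O c d}
        fun a b hab => by
          obtain h | h := hOcover a b hab
          · simp only [hsource h, not_false_eq_true]
          · simp only [hsource h, not_true_eq_false]
      · right
        intro a b hab n
        by_cases hadj : G.Adj a b
        · exact h a (hsource ((hOcover a b hadj).resolve_right hab)).1 b n
        · rw [ZigzagAlgebra.x_of_not_adj hadj, zero_smul]
      · left
        intro a b hab n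
        by_cases hadj : G.Adj a b
        · exact h a (hsource ((hOcover a b hadj).resolve_left hab)).2 b n
        · rw [ZigzagAlgebra.x_of_not_adj hadj, zero_smul]

end
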